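/- arXiv:1703.10444 — 6 statements merged into one kernel-verified Lean document; each statement's English description precedes it below -/
import Mathlib

section
/- Let d ≥ 2 be a natural number and let 0 ≤ λ < ε ≤ 1 be real numbers. Set c = 8(1-ε)/(15(1-λ)) and t = 2(ε-λ)/(1-λ), and assume t ≤ 1 and c·d + t·d·log₂(e/t) ≤ d - 1. Then for every nonempty set U ⊆ {0,1}^d with |U| ≤ 2^{c·d}, the average Hamming distance of a uniformly random z ∈ {0,1}^d to U satisfies (1/2^d) ∑_{z ∈ {0,1}^d} dist(z,U) ≥ ((ε-λ)/(1-λ))·d. -/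
/-- The generating function of the Hamming distances to a fixed point of the cube. -/
theorem sum_pow_hammingDist {ι : Type*} [Fintype ι] [DecidableEq ι] (t : ℝ) (u : ι → Bool) :
    ∑ z : ι → Bool, t ^ hammingDist z u = (1 + t) ^ Fintype.card ι := by
  have h (z : ι → Bool) : t ^ hammingDist z u = ∏ i, if z i ≠ u i then t else 1 := by
    rw [Finset.prod_ite]
    simp [hammingDist]
  have hsum (i : ι) : ∑ b : Bool, (if b ≠ u i then t else 1) = 1 + t := by
    cases u i <;> simp [add_comm]
  simp_rw [h]
  rw [← Fintype.prod_sum fun i b => if b ≠ u i then t else 1]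
  simp only [hsum, Finset.prod_const, Finset.card_univ]

/-- The distance to a finite set is bounded below by an exponentially weighted count. -/
theorem mul_one_sub_sum_le_inf_hammingDist {ι : Type*} [Fintype ι] {t r : ℝ} (ht0 : 0 < t)
    (ht1 : t ≤ 1) (hr : 0 ≤ r) (U : Finset (ι → Bool)) (hU : U.Nonempty) (z : ι → Bool) :
    r * (1 - t ^ (-r) * ∑ u ∈ U, t ^ hammingDist z u) ≤
      ((U.inf' hU fun u => hammingDist z u : ℕ) : ℝ) := by
  obtain ⟨v, hv, hinf⟩ := U.exists_mem_eq_inf' hU fun u => hammingDist z u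
  rw [hinf]
  have hsum : t ^ hammingDist z v ≤ ∑ u ∈ U, t ^ hammingDist z u :=
    Finset.single_le_sum (f := fun u => t ^ hammingDist z u) (fun _ _ => by positivity) hv
  have htr : 0 < t ^ (-r) := Real.rpow_pos_of_pos ht0 _
  rcases le_total (hammingDist z v : ℝ) r with h | h
  · have hone : 1 ≤ t ^ (-r) * t ^ hammingDist z v := by
      rw [← Real.rpow_natCast, ← Real.rpow_add ht0]
      exact Real.one_le_rpow_of_pos_of_le_one_of_nonpos ht0 ht1 (by linarith)
    have hbound := hone.trans (mul_le_mul_of_nonneg_left hsum htr.le)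
    exact (mul_nonpos_of_nonneg_of_nonpos hr (by linarith)).trans (Nat.cast_nonneg _)
  · have hnonneg : 0 ≤ t ^ (-r) * ∑ u ∈ U, t ^ hammingDist z u := by positivity
    nlinarith

theorem rpow_neg_mul_one_add_pow_le {t : ℝ} (ht0 : 0 < t) (d : ℕ) :
    t ^ (-(t * d)) * (1 + t) ^ d ≤ 2 ^ (t * d * Real.logb 2 (Real.exp 1 / t)) := by
  have hexp : (1 + t) ^ d ≤ Real.exp (t * d) := by
    rw [mul_comm t, Real.exp_nat_mul]
    exact pow_le_pow_left₀ (by positivity) (by linarith [Real.add_one_le_exp t]) d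
  calc t ^ (-(t * d)) * (1 + t) ^ d ≤ t ^ (-(t * d)) * Real.exp (t * d) := by gcongr
    _ = (Real.exp 1 / t) ^ (t * d) := by
      rw [Real.div_rpow (Real.exp_pos 1).le ht0.le, Real.exp_one_rpow, Real.rpow_neg ht0.le]
      ring
    _ = 2 ^ (t * d * Real.logb 2 (Real.exp 1 / t)) := by
      rw [mul_comm (t * d), Real.rpow_mul two_pos.le,
        Real.rpow_logb two_pos (by norm_num) (by positivity)]


/-- The decoding-error lemma: for `d ≥ 2`, `0 ≤ λ < ε ≤ 1`, with
`c = 8(1-ε)/(15(1-λ))` and `t = 2(ε-λ)/(1-λ)`, if `t ≤ 1` and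
`c·d + t·d·log₂(e/t) ≤ d - 1`, then every nonempty `U ⊆ {0,1}^d` with
`|U| ≤ 2^(c·d)` has average Hamming distance to a uniform `z ∈ {0,1}^d`
at least `((ε-λ)/(1-λ))·d`. -/
theorem avg_dist_ge_of_small_codebook
    (d : ℕ) (hd : 2 ≤ d) (lam eps : ℝ)
    (hlam : 0 ≤ lam) (hle : lam < eps) (heps : eps ≤ 1)
    (ht : 2 * (eps - lam) / (1 - lam) ≤ 1)
    (hcd : (8 * (1 - eps) / (15 * (1 - lam))) * d
          + (2 * (eps - lam) / (1 - lam)) * d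
            * Real.logb 2 (Real.exp 1 / (2 * (eps - lam) / (1 - lam)))
        ≤ (d : ℝ) - 1)
    (U : Finset (Fin d → Bool)) (hU : U.Nonempty)
    (hcard : (U.card : ℝ) ≤ (2 : ℝ) ^ ((8 * (1 - eps) / (15 * (1 - lam))) * (d : ℝ))) :
    ((eps - lam) / (1 - lam)) * d ≤ (1 / 2 ^ d) *
      ∑ z : Fin d → Bool, ((U.inf' hU fun u => hammingDist z u : ℕ) : ℝ) := by
  set c := 8 * (1 - eps) / (15 * (1 - lam))
  set t := 2 * (eps - lam) / (1 - lam) with ht_def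
  have ht0 : 0 < t := div_pos (by linarith) (by linarith)
  have hhalf : (eps - lam) / (1 - lam) = t / 2 := by rw [ht_def]; ring
  have hsmall : t ^ (-(t * d)) * ((U.card : ℝ) * (1 + t) ^ d) ≤ 2 ^ d / 2 := by
    calc t ^ (-(t * d)) * ((U.card : ℝ) * (1 + t) ^ d)
        = (U.card : ℝ) * (t ^ (-(t * d)) * (1 + t) ^ d) := by ring
      _ ≤ 2 ^ (c * d) * 2 ^ (t * d * Real.logb 2 (Real.exp 1 / t)) :=
        mul_le_mul hcard (rpow_neg_mul_one_add_pow_le ht0 d) (by positivity) (by positivity)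
      _ = 2 ^ (c * d + t * d * Real.logb 2 (Real.exp 1 / t)) := (Real.rpow_add two_pos _ _).symm
      _ ≤ 2 ^ ((d : ℝ) - 1) := Real.rpow_le_rpow_of_exponent_le one_le_two hcd
      _ = 2 ^ d / 2 := by rw [Real.rpow_sub_one two_ne_zero, Real.rpow_natCast]
  have hsum := Finset.sum_le_sum fun z (_ : z ∈ Finset.univ) =>
    mul_one_sub_sum_le_inf_hammingDist ht0 ht (r := t * d) (by positivity) U hU z
  rw [← Finset.mul_sum, Finset.sum_sub_distrib, ← Finset.mul_sum, Finset.sum_comm] at hsum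
  simp only [sum_pow_hammingDist, Finset.sum_const, Finset.card_univ, Fintype.card_pi_const,
    Fintype.card_bool, Fintype.card_fin, nsmul_eq_mul, mul_one, Nat.cast_pow,
    Nat.cast_ofNat] at hsum
  rw [hhalf, one_div, ← div_eq_inv_mul, le_div_iff₀ (by positivity)]
  calc t / 2 * d * 2 ^ d = t * d * (2 ^ d - 2 ^ d / 2) := by ring
    _ ≤ t * d * (2 ^ d - t ^ (-(t * d)) * ((U.card : ℝ) * (1 + t) ^ d)) := by gcongr
    _ ≤ _ := hsum
end

section
/- Let d ≥ 2 be a natural number and let 0 ≤ λ < ε ≤ 1 be real numbers. Set c = 8(1-ε)/(15(1-λ)) and t = 2(ε-λ)/(1-λ), and assume t ≤ 1 and c·d + t·d·log₂(e/t) ≤ d - 1. Let M be a nonempty finite set with |M| ≤ 2^{c·d}, and let P₁ : {0,1}^d → M and P₂ : M → {0,1}^d be arbitrary functions. Then (1-λ) · (1/(d·2^d)) · ∑_{z ∈ {0,1}^d} dist(z, P₂(P₁(z))) + λ ≥ ε. -/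
/-- A Hamming ball of radius `t * d` in `{0,1}^d` has at most `(e / t) ^ (t * d)` points. -/
theorem card_hammingBall_le {d : ℕ} {t : ℝ} (ht0 : 0 < t) (ht1 : t ≤ 1) (u : Fin d → Bool) :
    ((Finset.univ.filter fun z : Fin d → Bool => (hammingDist z u : ℝ) ≤ t * d).card : ℝ)
      ≤ (Real.exp 1 / t) ^ (t * d) := by
  have hpos : 0 < t ^ (t * d) := Real.rpow_pos_of_pos ht0 _
  rw [Real.div_rpow (Real.exp_pos 1).le ht0.le, le_div_iff₀ hpos, Real.exp_one_rpow]
  calc _ = ∑ z : Fin d → Bool with (hammingDist z u : ℝ) ≤ t * d, t ^ (t * d) := by simp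
    _ ≤ ∑ z : Fin d → Bool with (hammingDist z u : ℝ) ≤ t * d, t ^ hammingDist z u := by
      refine Finset.sum_le_sum fun z hz => ?_
      rw [← Real.rpow_natCast]
      exact Real.rpow_le_rpow_of_exponent_ge ht0 ht1 (Finset.mem_filter.mp hz).2
    _ ≤ ∑ z : Fin d → Bool, t ^ hammingDist z u :=
      Finset.sum_le_sum_of_subset_of_nonneg (Finset.filter_subset _ _)
        fun _ _ _ => pow_nonneg ht0.le _
    _ = (1 + t) ^ d := by rw [sum_pow_hammingDist, Fintype.card_fin]
    _ ≤ Real.exp t ^ d := by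
      gcongr
      linarith [Real.add_one_le_exp t]
    _ = Real.exp (t * d) := by rw [← Real.exp_nat_mul, mul_comm]

/-- If `c * d + t * d * log₂ (e / t) ≤ d - 1`, then encoding `{0,1}^d` into at most `2 ^ (c * d)`
messages and decoding incurs total Hamming error at least `2 ^ (d - 1) * (t * d)`. -/
theorem le_sum_hammingDist_of_card_le {d : ℕ} {c t : ℝ} (ht0 : 0 < t) (ht1 : t ≤ 1)
    (hcd : c * d + t * d * Real.logb 2 (Real.exp 1 / t) ≤ (d : ℝ) - 1)
    {M : Type*} [Fintype M] (hM : (Fintype.card M : ℝ) ≤ (2 : ℝ) ^ (c * d))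
    (P₁ : (Fin d → Bool) → M) (P₂ : M → (Fin d → Bool)) :
    (2 : ℝ) ^ d / 2 * (t * d) ≤ ∑ z : Fin d → Bool, (hammingDist z (P₂ (P₁ z)) : ℝ) := by
  classical
  let near := Finset.univ.filter fun z : Fin d → Bool =>
    (hammingDist z (P₂ (P₁ z)) : ℝ) ≤ t * d
  let far := Finset.univ.filter fun z : Fin d → Bool =>
    ¬ (hammingDist z (P₂ (P₁ z)) : ℝ) ≤ t * d
  have hvol : (Real.exp 1 / t) ^ (t * d) = (2 : ℝ) ^ (t * d * Real.logb 2 (Real.exp 1 / t)) := by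
    rw [mul_comm (t * d), Real.rpow_mul zero_le_two,
      Real.rpow_logb (by norm_num) (by norm_num) (by positivity)]
  have hnear : (near.card : ℝ) ≤ 2 ^ d / 2 := by
    have hsub : near ⊆ Finset.univ.biUnion fun m : M =>
        Finset.univ.filter fun z : Fin d → Bool => (hammingDist z (P₂ m) : ℝ) ≤ t * d := by
      intro z hz
      exact Finset.mem_biUnion.mpr ⟨P₁ z, Finset.mem_univ _,
        Finset.mem_filter.mpr ⟨Finset.mem_univ _, (Finset.mem_filter.mp hz).2⟩⟩
    calc (near.card : ℝ)
        ≤ ∑ m : M, ((Finset.univ.filter fun z : Fin d → Bool =>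
            (hammingDist z (P₂ m) : ℝ) ≤ t * d).card : ℝ) := by
          exact_mod_cast (Finset.card_le_card hsub).trans Finset.card_biUnion_le
      _ ≤ ∑ _m : M, (Real.exp 1 / t) ^ (t * d) :=
          Finset.sum_le_sum fun m _ => card_hammingBall_le ht0 ht1 (P₂ m)
      _ = Fintype.card M * (Real.exp 1 / t) ^ (t * d) := by simp
      _ ≤ (2 : ℝ) ^ (c * d) * (Real.exp 1 / t) ^ (t * d) := by gcongr
      _ = (2 : ℝ) ^ (c * d + t * d * Real.logb 2 (Real.exp 1 / t)) := by
          rw [hvol, Real.rpow_add (by norm_num)]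
      _ ≤ (2 : ℝ) ^ ((d : ℝ) - 1) := Real.rpow_le_rpow_of_exponent_le (by norm_num) hcd
      _ = 2 ^ d / 2 := by rw [Real.rpow_sub_one (by norm_num), Real.rpow_natCast]
  have hcard : (near.card : ℝ) + far.card = 2 ^ d := by
    have h : near.card + far.card = 2 ^ d := by
      simpa [near, far] using Finset.card_filter_add_card_filter_not (s := Finset.univ)
        (fun z : Fin d → Bool => (hammingDist z (P₂ (P₁ z)) : ℝ) ≤ t * d)
    exact_mod_cast h
  calc (2 : ℝ) ^ d / 2 * (t * d) ≤ far.card * (t * d) := by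
        gcongr
        linarith
    _ = ∑ z ∈ far, t * d := by simp
    _ ≤ ∑ z ∈ far, (hammingDist z (P₂ (P₁ z)) : ℝ) :=
        Finset.sum_le_sum fun z hz => (not_le.mp (Finset.mem_filter.mp hz).2).le
    _ ≤ _ := Finset.sum_le_sum_of_subset_of_nonneg (Finset.filter_subset _ _)
        fun _ _ _ => Nat.cast_nonneg _


/-- Core of the 1-round 2-machine communication lower bound: with
`c = 8(1-ε)/(15(1-λ))` and `t = 2(ε-λ)/(1-λ)`, if `t ≤ 1`,
`c·d + t·d·log₂(e/t) ≤ d - 1`, and the message set `M` is nonempty with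
`|M| ≤ 2^(c·d)`, then for any encoding `P₁ : {0,1}^d → M` and decoding
`P₂ : M → {0,1}^d`, the induced hypothesis error
`(1-λ)·(1/(d·2^d))·∑_z dist(z, P₂(P₁(z))) + λ` is at least `ε`. -/
theorem one_round_error_lower_bound
    (d : ℕ) (hd : 2 ≤ d) (lam eps : ℝ)
    (hlam : 0 ≤ lam) (hle : lam < eps) (heps : eps ≤ 1)
    (ht : 2 * (eps - lam) / (1 - lam) ≤ 1)
    (hcd : (8 * (1 - eps) / (15 * (1 - lam))) * d
          + (2 * (eps - lam) / (1 - lam)) * d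
            * Real.logb 2 (Real.exp 1 / (2 * (eps - lam) / (1 - lam)))
        ≤ (d : ℝ) - 1)
    (M : Type*) [Fintype M] [Nonempty M]
    (hM : (Fintype.card M : ℝ) ≤ (2 : ℝ) ^ ((8 * (1 - eps) / (15 * (1 - lam))) * (d : ℝ)))
    (P₁ : (Fin d → Bool) → M) (P₂ : M → (Fin d → Bool)) :
    eps ≤ (1 - lam) * (1 / ((d : ℝ) * 2 ^ d)) *
        (∑ z : Fin d → Bool, (hammingDist z (P₂ (P₁ z)) : ℝ)) + lam := by
  have hlam1 : 0 < 1 - lam := by linarith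
  have hd0 : (0 : ℝ) < d := by exact_mod_cast (by omega : 0 < d)
  have ht0 : 0 < 2 * (eps - lam) / (1 - lam) := div_pos (by linarith) hlam1
  have hsum := le_sum_hammingDist_of_card_le ht0 ht hcd hM P₁ P₂
  have hscaled := mul_le_mul_of_nonneg_left hsum
    (by positivity : 0 ≤ (1 - lam) * (1 / ((d : ℝ) * 2 ^ d)))
  have hval : (1 - lam) * (1 / ((d : ℝ) * 2 ^ d)) *
      ((2 : ℝ) ^ d / 2 * (2 * (eps - lam) / (1 - lam) * d)) = eps - lam := by
    field_simp
  linarith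
end

section
/- Let λ ∈ [0, 1/2) and ε ∈ (0, 1] be real numbers, let m ≥ 1 be a natural number, and let p ∈ [0,1] with p ≤ 1 - (1-λ)ε. If X is a binomial random variable with parameters m and p (the number of examples, out of m independent draws, with which the hypothesis agrees), then the probability that X ≥ (1 - ε/2)·m is at most exp(-m·ε·(1-2λ)²/(8(1-λ))). -/
/-- Second-order upper Taylor bound for `exp (-s)` with `0 ≤ s`. -/
theorem exp_neg_le_quadratic {s : ℝ} (hs : 0 ≤ s) :
    Real.exp (-s) ≤ 1 - s + s ^ 2 / 2 := by
  have hq := Real.quadratic_le_exp_of_nonneg hs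
  have hpos : 0 ≤ 1 - s + s ^ 2 / 2 := by nlinarith [sq_nonneg (s - 1)]
  rw [Real.exp_neg, inv_le_iff_one_le_mul₀ (Real.exp_pos s)]
  calc (1 : ℝ) ≤ (1 - s + s ^ 2 / 2) * (1 + s + s ^ 2 / 2) := by
        nlinarith [sq_nonneg (s ^ 2)]
    _ ≤ (1 - s + s ^ 2 / 2) * Real.exp s := mul_le_mul_of_nonneg_left hq hpos

/-- Exponential Markov bound for the upper tail of a binomial distribution, in terms of the
moment generating function of the number of failures. -/
theorem binomial_tail_le_exp_mul_pow {p s : ℝ} (hp0 : 0 ≤ p) (hp1 : p ≤ 1) (hs : 0 ≤ s)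
    (m : ℕ) (c : ℝ) :
    (∑ k ∈ Finset.range (m + 1),
        if (1 - c) * (m : ℝ) ≤ (k : ℝ) then
          (m.choose k : ℝ) * p ^ k * (1 - p) ^ (m - k)
        else 0)
      ≤ Real.exp (s * (c * m)) * (p + (1 - p) * Real.exp (-s)) ^ m := by
  have hq : 0 ≤ 1 - p := sub_nonneg.2 hp1
  rw [add_pow, Finset.mul_sum]
  refine Finset.sum_le_sum fun k hk => ?_
  have hkm : k ≤ m := Nat.lt_succ_iff.1 (Finset.mem_range.1 hk)
  split_ifs with h
  · have hexp : 1 ≤ Real.exp (s * (c * m)) * Real.exp (-s) ^ (m - k) := by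
      rw [← Real.exp_nat_mul, ← Real.exp_add, Real.one_le_exp_iff, Nat.cast_sub hkm]
      nlinarith
    calc (m.choose k : ℝ) * p ^ k * (1 - p) ^ (m - k)
        ≤ (m.choose k : ℝ) * p ^ k * (1 - p) ^ (m - k) *
            (Real.exp (s * (c * m)) * Real.exp (-s) ^ (m - k)) :=
          le_mul_of_one_le_right (by positivity) hexp
      _ = _ := by rw [mul_pow]; ring
  · positivity

/-- Chernoff-bound step: if `X ~ Binomial(m, p)` with `p ≤ 1 - (1-λ)ε`,
`λ ∈ [0, 1/2)`, `ε ∈ (0, 1]`, `m ≥ 1`, then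
`P(X ≥ (1 - ε/2)·m) ≤ exp(-m·ε·(1-2λ)²/(8(1-λ)))`. The probability is
written out explicitly as the binomial tail sum. -/
theorem binomial_tail_chernoff
    (lam eps : ℝ) (hlam0 : 0 ≤ lam) (hlam : lam < 1 / 2)
    (heps0 : 0 < eps) (heps1 : eps ≤ 1)
    (m : ℕ) (hm : 1 ≤ m)
    (p : ℝ) (hp0 : 0 ≤ p) (hp1 : p ≤ 1) (hp : p ≤ 1 - (1 - lam) * eps) :
    (∑ k ∈ Finset.range (m + 1),
        if (1 - eps / 2) * (m : ℝ) ≤ (k : ℝ) then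
          (m.choose k : ℝ) * p ^ k * (1 - p) ^ (m - k)
        else 0)
      ≤ Real.exp (-(m : ℝ) * eps * (1 - 2 * lam) ^ 2 / (8 * (1 - lam))) := by
  have ha : 0 < 1 - lam := by linarith
  set s : ℝ := (1 - 2 * lam) / (2 * (1 - lam)) with hs_def
  have hs : 0 ≤ s := div_nonneg (by linarith) (by linarith)
  have hexp := exp_neg_le_quadratic hs
  have hexp1 : Real.exp (-s) ≤ 1 := Real.exp_le_one_iff.2 (by linarith)
  have hmgf : p + (1 - p) * Real.exp (-s) ≤
      Real.exp (-((1 - lam) * eps * (s - s ^ 2 / 2))) := by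
    have h1 : (1 - lam) * eps * (1 - Real.exp (-s)) ≤ (1 - p) * (1 - Real.exp (-s)) :=
      mul_le_mul_of_nonneg_right (by linarith) (by linarith)
    have h2 : (1 - lam) * eps * (s - s ^ 2 / 2) ≤ (1 - lam) * eps * (1 - Real.exp (-s)) :=
      mul_le_mul_of_nonneg_left (by linarith) (by positivity)
    linarith [Real.add_one_le_exp (-((1 - lam) * eps * (s - s ^ 2 / 2)))]
  have hmgf0 : 0 ≤ p + (1 - p) * Real.exp (-s) :=
    add_nonneg hp0 (mul_nonneg (by linarith) (Real.exp_pos _).le)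
  refine (binomial_tail_le_exp_mul_pow hp0 hp1 hs m (eps / 2)).trans ?_
  calc Real.exp (s * (eps / 2 * m)) * (p + (1 - p) * Real.exp (-s)) ^ m
      ≤ Real.exp (s * (eps / 2 * m)) *
          Real.exp (-((1 - lam) * eps * (s - s ^ 2 / 2))) ^ m := by gcongr
    _ = Real.exp (-(m : ℝ) * eps * (1 - 2 * lam) ^ 2 / (8 * (1 - lam))) := by
      rw [← Real.exp_nat_mul, ← Real.exp_add, hs_def]
      congr 1
      field_simp
      ring
end

section
/- Let X be a measurable space, let μ and η be probability measures on X, let λ ∈ [0, 1/2), and set ν = (1-λ)·μ + λ·η. Let H be a finite set of measurable functions h : X → {0,1}, let ε, δ ∈ (0,1), and let m ≥ 1 be a natural number with m ≥ (8(1-λ)/(ε(1-2λ)²)) · (ln|H| + ln(2/δ)). Then, for ω = (x₁,…,x_m) drawn i.i.d. from ν (i.e., from the m-fold product measure ν^{⊗m}), the probability of the event that there exists h ∈ H with μ({x : h(x) = 0}) ≥ ε and |{i : h(x_i) = 1}| ≥ (1 - ε/2)·m is at most δ/2. -/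
open MeasureTheory

open ProbabilityTheory

lemma sq_sub_one_div_two_le_mul_log {r : ℝ} (hr0 : 0 < r) (hr1 : r ≤ 1) :
    (r ^ 2 - 1) / 2 ≤ r * Real.log r := by
  have h : Real.sinh (Real.log r) ≤ Real.log r :=
    Real.sinh_le_self_iff.2 (Real.log_nonpos hr0.le hr1)
  rw [Real.sinh_log hr0] at h
  calc (r ^ 2 - 1) / 2 = r * ((r - r⁻¹) / 2) := by field_simp
    _ ≤ r * Real.log r := mul_le_mul_of_nonneg_left h hr0.le

/-- Integral of a product of identical factors over a finite power of a probability space. -/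
lemma lintegral_pi_prod_eq_pow {X ι : Type*} [MeasurableSpace X] [Fintype ι] (ν : Measure X)
    [IsProbabilityMeasure ν] {g : X → ENNReal} (hg : Measurable g) :
    ∫⁻ ω, ∏ i, g (ω i) ∂(Measure.pi fun _ : ι => ν) = (∫⁻ x, g x ∂ν) ^ Fintype.card ι := by
  rw [lintegral_prod_eq_prod_lintegral_of_indepFun Finset.univ (fun i (ω : ι → X) => g (ω i))
    (iIndepFun_pi fun _ => hg.aemeasurable) fun i => hg.comp (measurable_pi_apply i)]
  simp [fun i : ι => (measurePreserving_eval (fun _ : ι => ν) i).lintegral_comp hg]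

/-- Multiplicative Chernoff bound for the lower tail of the number of samples hitting `S`. -/
lemma measure_pi_card_mem_le_le {X ι : Type*} [MeasurableSpace X] [Fintype ι] (ν : Measure X)
    [IsProbabilityMeasure ν] {S : Set X} [DecidablePred (· ∈ S)] (hS : MeasurableSet S) {q r : ℝ}
    (hq : q ≤ ν.real S) (hr0 : 0 < r) (hr1 : r ≤ 1) (hq0 : 0 ≤ q) :
    (Measure.pi fun _ : ι => ν)
        {ω | ((Finset.univ.filter fun i => ω i ∈ S).card : ℝ) ≤ r * q * Fintype.card ι}
      ≤ ENNReal.ofReal (Real.exp (-((1 - r) ^ 2 * q / 2 * Fintype.card ι))) := by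
  set C : ℝ := Real.exp (-Real.log r * (r * q)) with hC
  set f : X → ℝ := fun x => C * (1 - (1 - r) * S.indicator 1 x) with hf
  have hf_if (x : X) : f x = C * if x ∈ S then r else 1 := by
    by_cases hx : x ∈ S <;> simp [hf, hx]
  have hf0 (x : X) : 0 ≤ f x := by
    rw [hf_if]
    split_ifs <;> positivity
  have hind : Measurable (S.indicator (1 : X → ℝ)) := measurable_one.indicator hS
  have hfm : Measurable f := by fun_prop
  have hgm : Measurable fun x => ENNReal.ofReal (f x) := hfm.ennreal_ofReal
  have hindi : Integrable (S.indicator (1 : X → ℝ)) ν :=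
    (integrable_const (1 : ℝ)).indicator hS
  have hfi : Integrable f ν := ((integrable_const 1).sub (hindi.const_mul _)).const_mul _
  have hint : ∫ x, f x ∂ν = C * (1 - (1 - r) * ν.real S) := by
    rw [hf, integral_const_mul, integral_sub (integrable_const 1) (hindi.const_mul _),
      integral_const_mul, integral_indicator_one hS]
    simp
  have hint_le : ∫ x, f x ∂ν ≤ Real.exp (-((1 - r) ^ 2 * q / 2)) := by
    calc ∫ x, f x ∂ν = C * (1 - (1 - r) * ν.real S) := hint
      _ ≤ C * Real.exp (-((1 - r) * q)) := by
        gcongr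
        have := Real.add_one_le_exp (-((1 - r) * q))
        have := mul_le_mul_of_nonneg_left hq (sub_nonneg.2 hr1)
        linarith
      _ ≤ Real.exp (-((1 - r) ^ 2 * q / 2)) := by
        rw [hC, ← Real.exp_add, Real.exp_le_exp]
        have := mul_le_mul_of_nonneg_right (sq_sub_one_div_two_le_mul_log hr0 hr1) hq0
        linarith
  calc _ ≤ ∫⁻ ω, ∏ i, ENNReal.ofReal (f (ω i)) ∂(Measure.pi fun _ : ι => ν) := by
        have hprod : Measurable fun ω : ι → X => ∏ i, ENNReal.ofReal (f (ω i)) :=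
          Finset.measurable_prod _ fun i _ => hgm.comp (measurable_pi_apply i)
        refine meas_le_lintegral₀ hprod.aemeasurable fun ω hω => ?_
        rw [← ENNReal.ofReal_prod_of_nonneg fun i _ => hf0 _, ENNReal.one_le_ofReal]
        simp only [hf_if, Finset.prod_mul_distrib, Finset.prod_const, Finset.card_univ,
          Finset.prod_ite, one_pow, mul_one]
        rw [← Real.exp_log (pow_pos hr0 _), Real.log_pow, hC, ← Real.exp_nat_mul,
          ← Real.exp_add, Real.one_le_exp_iff]
        have := mul_le_mul_of_nonneg_left (Set.mem_ofPred_eq ▸ hω)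
          (neg_nonneg.2 (Real.log_nonpos hr0.le hr1))
        linarith
    _ = ENNReal.ofReal ((∫ x, f x ∂ν) ^ Fintype.card ι) := by
        rw [lintegral_pi_prod_eq_pow ν hgm,
          ← ofReal_integral_eq_lintegral_ofReal hfi (ae_of_all _ hf0),
          ENNReal.ofReal_pow (integral_nonneg hf0)]
    _ ≤ _ := by
        refine ENNReal.ofReal_le_ofReal ?_
        calc _ ≤ Real.exp (-((1 - r) ^ 2 * q / 2)) ^ Fintype.card ι :=
              pow_le_pow_left₀ (integral_nonneg hf0) hint_le _
          _ = _ := by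
              rw [← Real.exp_nat_mul]
              ring_nf


/-- Sample complexity for robust PAC learning (oblivious adversary):
examples are drawn i.i.d. from the mixture `ν = (1-λ)μ + λη`.  If
`m ≥ (8(1-λ)/(ε(1-2λ)²))·(ln|H| + ln(2/δ))`, then with probability at most
`δ/2` some hypothesis `h ∈ H` with true error `μ{x : h x = 0} ≥ ε` agrees
with at least a `(1-ε/2)` fraction of the `m` samples.  Here hypotheses are
`Bool`-valued, `h x = false` meaning `h` errs on the positive example `x`. -/
theorem robust_pac_sample_complexity
    {X : Type*} [MeasurableSpace X] (μ η : Measure X)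
    [IsProbabilityMeasure μ] [IsProbabilityMeasure η]
    (lam : ℝ) (hlam0 : 0 ≤ lam) (hlam : lam < 1 / 2)
    (H : Finset (X → Bool)) (hH : ∀ h ∈ H, Measurable h)
    (eps δ : ℝ) (heps0 : 0 < eps) (heps1 : eps < 1) (hδ0 : 0 < δ) (hδ1 : δ < 1)
    (m : ℕ) (hm1 : 1 ≤ m)
    (hm : (8 * (1 - lam) / (eps * (1 - 2 * lam) ^ 2))
          * (Real.log H.card + Real.log (2 / δ)) ≤ (m : ℝ)) :
    (Measure.pi fun _ : Fin m => ENNReal.ofReal (1 - lam) • μ + ENNReal.ofReal lam • η)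
        {ω : Fin m → X | ∃ h ∈ H,
          ENNReal.ofReal eps ≤ μ {x | h x = false} ∧
          (1 - eps / 2) * (m : ℝ)
            ≤ ((Finset.univ.filter fun i : Fin m => h (ω i) = true).card : ℝ)}
      ≤ ENNReal.ofReal (δ / 2) := by
  rcases H.eq_empty_or_nonempty with rfl | hne
  · simp
  have hlam' : 0 < 1 - lam := by linarith
  have hcard : (0 : ℝ) < H.card := by exact_mod_cast hne.card_pos
  set ν := ENNReal.ofReal (1 - lam) • μ + ENNReal.ofReal lam • η with hν
  have hνprob : IsProbabilityMeasure ν := ⟨by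
    simp [hν, ← ENNReal.ofReal_add hlam'.le hlam0]⟩
  set r : ℝ := 1 / (2 * (1 - lam)) with hr
  have hr1 : r ≤ 1 := by
    rw [hr, div_le_one (by linarith)]
    linarith
  have hexp : Real.exp (-((1 - r) ^ 2 * ((1 - lam) * eps) / 2 * m)) ≤ δ / 2 / H.card := by
    have hden : 0 < eps * (1 - 2 * lam) ^ 2 := mul_pos heps0 (pow_pos (by linarith) 2)
    rw [div_mul_eq_mul_div, div_le_iff₀ hden] at hm
    rw [← Real.le_log_iff_exp_le (by positivity), Real.log_div (by positivity) hcard.ne',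
      ← inv_div 2 δ, Real.log_inv]
    have hrate : (1 - r) ^ 2 * ((1 - lam) * eps) / 2 * m
        = m * (eps * (1 - 2 * lam) ^ 2) / (8 * (1 - lam)) := by
      rw [hr]
      field_simp
      ring
    have := (le_div_iff₀' (by linarith : 0 < 8 * (1 - lam))).2 hm
    linarith
  have hbad : ∀ h ∈ H, (Measure.pi fun _ : Fin m => ν)
      {ω | ENNReal.ofReal eps ≤ μ {x | h x = false} ∧ (1 - eps / 2) * (m : ℝ)
        ≤ ((Finset.univ.filter fun i : Fin m => h (ω i) = true).card : ℝ)}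
      ≤ ENNReal.ofReal (δ / 2 / H.card) := by
    intro h hh
    by_cases hμ : ENNReal.ofReal eps ≤ μ {x | h x = false}
    swap
    · simp [hμ]
    have hq : (1 - lam) * eps ≤ ν.real {x | h x = false} := by
      refine (ENNReal.ofReal_le_iff_le_toReal (measure_ne_top _ _)).1 ?_
      rw [ENNReal.ofReal_mul hlam'.le, hν, Measure.add_apply, Measure.smul_apply, smul_eq_mul]
      exact le_add_right (mul_le_mul_right hμ _)
    refine (measure_mono ?_).trans ((measure_pi_card_mem_le_le (ι := Fin m) ν
      (S := {x | h x = false}) (hH h hh (measurableSet_singleton false)) hq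
      (by positivity : 0 < r) hr1 (by positivity)).trans ?_)
    · rintro ω ⟨-, hω⟩
      have hsum := Finset.card_filter_add_card_filter_not (s := (Finset.univ : Finset (Fin m)))
        (fun i => h (ω i) = true)
      simp only [Bool.not_eq_true, Finset.card_univ, Fintype.card_fin] at hsum
      have hsum' := congrArg (Nat.cast : ℕ → ℝ) hsum
      push_cast at hsum'
      have hrq : r * ((1 - lam) * eps) = eps / 2 := by
        rw [hr]
        field_simp
      simp only [Set.mem_ofPred_eq, Fintype.card_fin, hrq]
      linarith
    · rw [Fintype.card_fin]
      exact ENNReal.ofReal_le_ofReal hexp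
  calc _ = (Measure.pi fun _ : Fin m => ν) (⋃ h ∈ H,
        {ω | ENNReal.ofReal eps ≤ μ {x | h x = false} ∧ (1 - eps / 2) * (m : ℝ)
          ≤ ((Finset.univ.filter fun i : Fin m => h (ω i) = true).card : ℝ)}) := by
        congr 1
        ext ω
        simp only [Set.mem_iUnion, Set.mem_ofPred_eq, exists_prop]
    _ ≤ ∑ h ∈ H, ENNReal.ofReal (δ / 2 / H.card) :=
        (measure_biUnion_finset_le _ _).trans (Finset.sum_le_sum hbad)
    _ = ENNReal.ofReal (δ / 2) := by
        rw [← ENNReal.ofReal_sum_of_nonneg fun _ _ => by positivity, Finset.sum_const,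
          nsmul_eq_mul, mul_div_cancel₀ _ hcard.ne']
end

section
/- Let s be a nonempty finite index set with n = |s|, let T be a natural number, let ρ ≥ 0 and c' ∈ [0,1] be real numbers. Let w : ℕ → s → ℝ be weights with w(0, i) = 1 for all i ∈ s, and for each t < T let M_t ⊆ s be a subset satisfying ∑_{i ∈ M_t} w(t, i) ≤ c' · ∑_{i ∈ s} w(t, i), with the update rule w(t+1, i) = (1+ρ)·w(t, i) if i ∈ M_t and w(t+1, i) = w(t, i) otherwise. Let S = {i ∈ s : |{t < T : i ∈ M_t}| ≥ T/2}. Then |S| · (1+ρ)^{T/2} ≤ n · (1 + c'·ρ)^T. -/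
open Finset in
/-- Under the multiplicative update, a weight is `1 + ρ` to the number of rounds in which
its point was misclassified. -/
theorem weight_eq_one_add_pow_card {ι : Type*} [DecidableEq ι] {T : ℕ} {ρ : ℝ}
    {w : ℕ → ι → ℝ} {M : ℕ → Finset ι} (hw0 : ∀ i, w 0 i = 1)
    (hupd : ∀ t < T, ∀ i : ι, w (t + 1) i = if i ∈ M t then (1 + ρ) * w t i else w t i)
    {t : ℕ} (ht : t ≤ T) (i : ι) :
    w t i = (1 + ρ) ^ #{k ∈ range t | i ∈ M k} := by
  induction t with
  | zero => simp [hw0]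
  | succ t ih =>
    rw [hupd t ht, ih (by omega), range_add_one, filter_insert]
    split_ifs
    · rw [card_insert_of_notMem (by simp), pow_succ']
    · rfl

/-- If the misclassified set carries at most a `c` fraction of the total weight in every round,
then the total weight grows by a factor of at most `1 + c * ρ` per round. -/
theorem sum_weight_le_card_mul_pow {ι : Type*} [Fintype ι] [DecidableEq ι] {T : ℕ} {ρ c : ℝ}
    (hρ : 0 ≤ ρ) (hc : 0 ≤ c) {w : ℕ → ι → ℝ} {M : ℕ → Finset ι} (hw0 : ∀ i, w 0 i = 1)
    (hM : ∀ t < T, ∑ i ∈ M t, w t i ≤ c * ∑ i : ι, w t i)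
    (hupd : ∀ t < T, ∀ i : ι, w (t + 1) i = if i ∈ M t then (1 + ρ) * w t i else w t i)
    {t : ℕ} (ht : t ≤ T) :
    ∑ i, w t i ≤ Fintype.card ι * (1 + c * ρ) ^ t := by
  induction t with
  | zero => simp [hw0]
  | succ t ih =>
    have step (i : ι) : w (t + 1) i = w t i + if i ∈ M t then ρ * w t i else 0 := by
      rw [hupd t ht]
      split_ifs <;> ring
    calc ∑ i, w (t + 1) i = ∑ i, w t i + ρ * ∑ i ∈ M t, w t i := by
          simp [step, Finset.sum_add_distrib, Finset.mul_sum]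
      _ ≤ ∑ i, w t i + ρ * (c * ∑ i, w t i) := by
          gcongr
          exact hM t ht
      _ = (∑ i, w t i) * (1 + c * ρ) := by ring
      _ ≤ (Fintype.card ι * (1 + c * ρ) ^ t) * (1 + c * ρ) := by
          gcongr
          exact ih (by omega)
      _ = Fintype.card ι * (1 + c * ρ) ^ (t + 1) := by ring

/-- Potential-function argument of the Weighted Sampling analysis: starting
from unit weights, for `T` rounds the misclassified set `M t` carries at most
a `c'` fraction of the total weight and has its weights multiplied by `1+ρ`.
Then the set `S` of points misclassified in at least `T/2` rounds satisfies
`|S|·(1+ρ)^{T/2} ≤ n·(1+c'·ρ)^T`. -/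
theorem weighted_sampling_potential
    {ι : Type*} [Fintype ι] [Nonempty ι] [DecidableEq ι]
    (T : ℕ) (ρ c' : ℝ) (hρ : 0 ≤ ρ) (hc'0 : 0 ≤ c') (hc'1 : c' ≤ 1)
    (w : ℕ → ι → ℝ) (hw0 : ∀ i, w 0 i = 1)
    (M : ℕ → Finset ι)
    (hM : ∀ t < T, ∑ i ∈ M t, w t i ≤ c' * ∑ i : ι, w t i)
    (hupd : ∀ t < T, ∀ i : ι, w (t + 1) i = if i ∈ M t then (1 + ρ) * w t i else w t i) :
    ((Finset.univ.filter fun i : ι =>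
          (T : ℝ) / 2 ≤ (((Finset.range T).filter fun t => i ∈ M t).card : ℝ)).card : ℝ)
        * (1 + ρ) ^ ((T : ℝ) / 2)
      ≤ (Fintype.card ι : ℝ) * (1 + c' * ρ) ^ T := by
  have hw := weight_eq_one_add_pow_card hw0 hupd le_rfl
  refine le_trans ?_ (sum_weight_le_card_mul_pow hρ hc'0 hw0 hM hupd le_rfl)
  rw [← nsmul_eq_mul]
  refine (Finset.card_nsmul_le_sum _ (w T) _ fun i hi => ?_).trans
    (Finset.sum_le_univ_sum_of_nonneg fun i => ?_)
  · rw [hw, ← Real.rpow_natCast]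
    exact Real.rpow_le_rpow_of_exponent_le (by linarith) (Finset.mem_filter.mp hi).2
  · rw [hw]
    positivity
end

section
/- Let s be a nonempty finite index set with n = |s|, let ε ∈ (0,1), and let T be a natural number with T ≥ 5·log₂(1/ε). Set ρ = 3/4 and c' = 1/5. Let w : ℕ → s → ℝ be weights with w(0, i) = 1 for all i ∈ s, and for each t < T let M_t ⊆ s be a subset satisfying ∑_{i ∈ M_t} w(t, i) ≤ c' · ∑_{i ∈ s} w(t, i), with the update rule w(t+1, i) = (1+ρ)·w(t, i) if i ∈ M_t and w(t+1, i) = w(t, i) otherwise. Let S = {i ∈ s : |{t < T : i ∈ M_t}| ≥ T/2}. Then |S| < ε·n. -/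
open Finset in
theorem weight_eq_pow_card {ι : Type*} [DecidableEq ι] (r : ℝ) (w : ℕ → ι → ℝ)
    (M : ℕ → Finset ι) (hw0 : ∀ i, w 0 i = 1) (T : ℕ)
    (hupd : ∀ t < T, ∀ i, w (t + 1) i = if i ∈ M t then r * w t i else w t i) (i : ι) :
    w T i = r ^ ((range T).filter fun t => i ∈ M t).card := by
  induction T with
  | zero => simp [hw0]
  | succ T ih =>
    rw [hupd T T.lt_succ_self i, ih fun t ht => hupd t (ht.trans T.lt_succ_self),
      range_add_one, filter_insert]
    split_ifs with h
    · rw [card_insert_of_notMem (by simp), pow_succ']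
    · rfl

open Finset in
theorem sum_weight_le {ι : Type*} [Fintype ι] [DecidableEq ι] (c ρ : ℝ) (hc : 0 ≤ c)
    (hρ : 0 ≤ ρ) (w : ℕ → ι → ℝ) (M : ℕ → Finset ι) (hw0 : ∀ i, w 0 i = 1) (T : ℕ)
    (hM : ∀ t < T, ∑ i ∈ M t, w t i ≤ c * ∑ i, w t i)
    (hupd : ∀ t < T, ∀ i, w (t + 1) i = if i ∈ M t then (1 + ρ) * w t i else w t i) :
    ∑ i, w T i ≤ Fintype.card ι * (1 + c * ρ) ^ T := by
  induction T with
  | zero => simp [hw0]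
  | succ T ih =>
    have hT := T.lt_succ_self
    have ih' := ih (fun t ht => hM t (ht.trans hT)) (fun t ht => hupd t (ht.trans hT))
    have hsum : ∑ i, w (T + 1) i = ∑ i, w T i + ρ * ∑ i ∈ M T, w T i := by
      have hind : ∑ i ∈ M T, w T i = ∑ i, if i ∈ M T then w T i else 0 := by simp
      rw [hind, mul_sum, ← sum_add_distrib]
      refine sum_congr rfl fun i _ => ?_
      rw [hupd T hT i]
      split_ifs <;> ring
    calc ∑ i, w (T + 1) i ≤ ∑ i, w T i + ρ * (c * ∑ i, w T i) := by
          rw [hsum]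
          gcongr
          exact hM T hT
      _ = (∑ i, w T i) * (1 + c * ρ) := by ring
      _ ≤ Fintype.card ι * (1 + c * ρ) ^ T * (1 + c * ρ) := by gcongr
      _ = Fintype.card ι * (1 + c * ρ) ^ (T + 1) := by ring

theorem one_div_two_pow_le_pow_of_logb_le {eps : ℝ} (heps : 0 < eps) {k T : ℕ}
    (hT : k * Real.logb 2 (1 / eps) ≤ T) : (1 / 2 : ℝ) ^ T ≤ eps ^ k := by
  rw [← Real.logb_pow, Real.logb_le_iff_le_rpow one_lt_two (by positivity),
    Real.rpow_natCast, one_div_pow] at hT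
  rw [one_div_pow]
  exact (one_div_le (by positivity) (by positivity)).mp hT

theorem pow_lt_eps_mul_sqrt_pow {eps : ℝ} (heps0 : 0 < eps) (heps1 : eps < 1) {T : ℕ}
    (hT : 5 * Real.logb 2 (1 / eps) ≤ (T : ℝ)) :
    (1 + 1 / 5 * (3 / 4) : ℝ) ^ T < eps * √((1 + 3 / 4 : ℝ) ^ T) := by
  have hT0 : T ≠ 0 := by
    rintro rfl
    have := Real.logb_pos one_lt_two (one_lt_one_div heps0 heps1)
    norm_num at hT this
    linarith
  have hhalf : (1 / 2 : ℝ) ^ T ≤ eps ^ 5 := one_div_two_pow_le_pow_of_logb_le heps0 hT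
  refine lt_of_pow_lt_pow_left₀ 10 (by positivity) ?_
  have hsqrt : √((1 + 3 / 4 : ℝ) ^ T) ^ 10 = ((1 + 3 / 4 : ℝ) ^ 5) ^ T := by
    rw [show 10 = 2 * 5 from rfl, pow_mul, Real.sq_sqrt (by positivity), pow_right_comm]
  calc ((1 + 1 / 5 * (3 / 4) : ℝ) ^ T) ^ 10 = ((1 + 1 / 5 * (3 / 4) : ℝ) ^ 10) ^ T :=
        pow_right_comm _ _ _
    _ < ((1 / 2) ^ 2 * (1 + 3 / 4 : ℝ) ^ 5) ^ T :=
        pow_lt_pow_left₀ (by norm_num) (by positivity) hT0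
    _ = ((1 / 2 : ℝ) ^ T) ^ 2 * ((1 + 3 / 4 : ℝ) ^ 5) ^ T := by
        rw [mul_pow, pow_right_comm]
    _ ≤ (eps ^ 5) ^ 2 * ((1 + 3 / 4 : ℝ) ^ 5) ^ T := by gcongr
    _ = (eps * √((1 + 3 / 4 : ℝ) ^ T)) ^ 10 := by rw [mul_pow, hsqrt, ← pow_mul]


/-- Quantitative conclusion of the Weighted Sampling analysis with `ρ = 3/4`,
`c' = 1/5` and `T ≥ 5·log₂(1/ε)` rounds: the set `S` of points misclassified
in at least `T/2` of the rounds has size strictly less than `ε·n`. -/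
theorem weighted_sampling_misclassified_lt
    {ι : Type*} [Fintype ι] [Nonempty ι] [DecidableEq ι]
    (eps : ℝ) (heps0 : 0 < eps) (heps1 : eps < 1)
    (T : ℕ) (hT : 5 * Real.logb 2 (1 / eps) ≤ (T : ℝ))
    (w : ℕ → ι → ℝ) (hw0 : ∀ i, w 0 i = 1)
    (M : ℕ → Finset ι)
    (hM : ∀ t < T, ∑ i ∈ M t, w t i ≤ (1 / 5 : ℝ) * ∑ i : ι, w t i)
    (hupd : ∀ t < T, ∀ i : ι,
      w (t + 1) i = if i ∈ M t then (1 + 3 / 4 : ℝ) * w t i else w t i) :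
    ((Finset.univ.filter fun i : ι =>
          (T : ℝ) / 2 ≤ (((Finset.range T).filter fun t => i ∈ M t).card : ℝ)).card : ℝ)
      < eps * (Fintype.card ι : ℝ) := by
  set S := Finset.univ.filter fun i : ι =>
    (T : ℝ) / 2 ≤ (((Finset.range T).filter fun t => i ∈ M t).card : ℝ) with hS
  have hw := weight_eq_pow_card _ w M hw0 T hupd
  have hweight : ∀ i ∈ S, √((1 + 3 / 4 : ℝ) ^ T) ≤ w T i := by
    intro i hi
    have hi' := (Finset.mem_filter.mp hi).2
    rw [hw i]
    refine Real.sqrt_le_iff.mpr ⟨by positivity, ?_⟩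
    rw [← pow_mul]
    refine pow_le_pow_right₀ (by norm_num) ?_
    exact_mod_cast (div_le_iff₀ two_pos).mp hi'
  have hlower : S.card * √((1 + 3 / 4 : ℝ) ^ T) ≤ ∑ i, w T i := by
    rw [← nsmul_eq_mul]
    refine (Finset.card_nsmul_le_sum S _ _ hweight).trans ?_
    refine Finset.sum_le_sum_of_subset_of_nonneg (Finset.subset_univ S) fun i _ _ => ?_
    rw [hw i]
    positivity
  have hupper := sum_weight_le (1 / 5) (3 / 4) (by norm_num) (by norm_num) w M hw0 T hM hupd
  have hcard : (0 : ℝ) < Fintype.card ι := by exact_mod_cast Fintype.card_pos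
  refine lt_of_mul_lt_mul_right ?_ (Real.sqrt_nonneg ((1 + 3 / 4 : ℝ) ^ T))
  calc S.card * √((1 + 3 / 4 : ℝ) ^ T) ≤ Fintype.card ι * (1 + 1 / 5 * (3 / 4) : ℝ) ^ T :=
        hlower.trans hupper
    _ < Fintype.card ι * (eps * √((1 + 3 / 4 : ℝ) ^ T)) := by
        gcongr
        exact pow_lt_eps_mul_sqrt_pow heps0 heps1 hT
    _ = eps * Fintype.card ι * √((1 + 3 / 4 : ℝ) ^ T) := by ring
end
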